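/- Let p ∈ ℂ[x] be nonzero and σ an anti-involution of 𝒟ᵃ_p preserving the principal ℤ-gradation. Let σ₀ : 𝒟ᵃ → 𝒟ᵃ be the unique map with σ(X·p(D)) = σ₀(X)·p(D) for all X ∈ 𝒟ᵃ (well-defined since X ↦ X·p(D) is injective on 𝒟ᵃ). Then: (a) σ₀ is ℂ-linear; (b) σ₀∘σ₀ = id; (c) σ₀(t^{k+m} f(D+m)p(D+m)g(D)) = σ₀(t^m g(D))·p(D)·σ₀(t^k f(D)) for all f, g ∈ ℂ[x] and k, m ∈ ℤ; (d) σ₀(f(D)g(D)p(D)) = σ₀(f(D))·σ₀(g(D))·p(D) for all f, g ∈ ℂ[x]. -/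

import Mathlib

noncomputable section

/-- ℂ[t,t⁻¹] as a ℂ-vector space with basis {t^j}_{j∈ℤ}; t^j is `Finsupp.single j 1`. -/
abbrev LaurentV : Type := ℤ →₀ ℂ

/-- The regular differential operator `t^k f(D)` (where D = t·d/dt), acting by
t^j ↦ f(j)·t^{j+k}. -/
def op (k : ℤ) (f : Polynomial ℂ) : Module.End ℂ LaurentV :=
  Finsupp.lsum ℂ fun j => f.eval (j : ℂ) • Finsupp.lsingle (j + k)

/-- The graded piece (𝒟ᵃ_p)_j = {t^j f(D) p(D) : f ∈ ℂ[x]}. -/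
def Dgrade (p : Polynomial ℂ) (j : ℤ) : Submodule ℂ (Module.End ℂ LaurentV) :=
  Submodule.span ℂ {A | ∃ f : Polynomial ℂ, A = op j (f * p)}

/-- 𝒟ᵃ_p = 𝒟ᵃ·p(D). -/
def Dp (p : Polynomial ℂ) : Submodule ℂ (Module.End ℂ LaurentV) :=
  Submodule.span ℂ {A | ∃ (k : ℤ) (f : Polynomial ℂ), A = op k (f * p)}

/-- σ is an anti-involution: it is ℂ-linear (built into the type), involutive, and
reverses products. -/
def IsAntiInvolutionOn (p : Polynomial ℂ) (σ : ↥(Dp p) →ₗ[ℂ] ↥(Dp p)) : Prop :=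
  (∀ A : ↥(Dp p), σ (σ A) = A) ∧
  (∀ A B W : ↥(Dp p),
    (W : Module.End ℂ LaurentV) = (A : Module.End ℂ LaurentV) * (B : Module.End ℂ LaurentV) →
    ((σ W : Module.End ℂ LaurentV)) = (σ B : Module.End ℂ LaurentV) * (σ A : Module.End ℂ LaurentV))

/-- σ preserves the principal ℤ-gradation. -/
def PreservesGrading (p : Polynomial ℂ) (σ : ↥(Dp p) →ₗ[ℂ] ↥(Dp p)) : Prop :=
  ∀ (j : ℤ) (A : ↥(Dp p)), (A : Module.End ℂ LaurentV) ∈ Dgrade p j →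
    ((σ A : Module.End ℂ LaurentV)) ∈ Dgrade p j

/-- σ(t^k f(D) p(D)) = (-1)^{deg p}·e^k·t^k f(−D−k+c)p(D). -/
def SigmaFormula (p : Polynomial ℂ) (c e : ℂ) (σ : ↥(Dp p) →ₗ[ℂ] ↥(Dp p)) : Prop :=
  ∀ (k : ℤ) (f : Polynomial ℂ) (A : ↥(Dp p)), (A : Module.End ℂ LaurentV) = op k (f * p) →
    ((σ A : Module.End ℂ LaurentV)) =
      ((-1 : ℂ) ^ p.natDegree * e ^ k) •
        op k ((f.comp (Polynomial.C (c - (k : ℂ)) - Polynomial.X)) * p)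

/-- The graded piece (𝒟_p^±)_k = {d ∈ (𝒟_p)_k : σ_±(d) = −d}, as a set. -/
def DpmGradeSet (p : Polynomial ℂ) (c e : ℂ) (k : ℤ) : Set (Module.End ℂ LaurentV) :=
  {A | ∃ f : Polynomial ℂ, A = op k (f * p) ∧
    ((-1 : ℂ) ^ p.natDegree * e ^ k) •
      op k ((f.comp (Polynomial.C (c - (k : ℂ)) - Polynomial.X)) * p) = -A}

/-- The graded piece (𝒟_p^±)_k, as a ℂ-subspace. -/
def DpmGrade (p : Polynomial ℂ) (c e : ℂ) (k : ℤ) : Submodule ℂ (Module.End ℂ LaurentV) :=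
  Submodule.span ℂ (DpmGradeSet p c e k)

/-- V has finite codimension in W. -/
def FinCodimIn {M : Type*} [AddCommGroup M] [Module ℂ M] (V W : Submodule ℂ M) : Prop :=
  FiniteDimensional ℂ (↥W ⧸ Submodule.comap W.subtype V)
lemma op_single (k : ℤ) (f : Polynomial ℂ) (j : ℤ) (c : ℂ) :
    op k f (Finsupp.single j c) = Finsupp.single (j + k) (f.eval (j : ℂ) * c) := by
  simp [op]

lemma op_mul_op (k m : ℤ) (f g : Polynomial ℂ) :
    op k f * op m g =
      op (k + m) (f.comp (Polynomial.X + Polynomial.C (m : ℂ)) * g) := by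
  refine Finsupp.lhom_ext fun j c => ?_
  rw [Module.End.mul_apply]
  simp only [op_single, Polynomial.eval_mul, Polynomial.eval_comp, Polynomial.eval_add,
    Polynomial.eval_X, Polynomial.eval_C]
  rw [show j + m + k = j + (k + m) by ring]
  push_cast
  rw [mul_assoc]

lemma op_zero_mul_op_zero (f g : Polynomial ℂ) : op 0 f * op 0 g = op 0 (f * g) := by
  simp [op_mul_op]

lemma op_add (k : ℤ) (f g : Polynomial ℂ) : op k (f + g) = op k f + op k g := by
  refine Finsupp.lhom_ext fun j c => ?_
  simp [op_single, add_mul]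

lemma op_smul (k : ℤ) (b : ℂ) (f : Polynomial ℂ) : op k (b • f) = b • op k f := by
  refine Finsupp.lhom_ext fun j c => ?_
  simp only [LinearMap.smul_apply, op_single, Polynomial.eval_smul, Finsupp.smul_single, smul_eq_mul,
    mul_assoc]

/-- Membership in a graded piece is realised by a single operator `t^j f(D)p(D)`. -/
lemma exists_eq_op_of_mem_Dgrade {p : Polynomial ℂ} {j : ℤ} {A : Module.End ℂ LaurentV}
    (hA : A ∈ Dgrade p j) : ∃ f : Polynomial ℂ, A = op j (f * p) := by
  induction hA using Submodule.span_induction with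
  | mem A h => exact h
  | zero => exact ⟨0, by simpa using (op_smul j 0 0).symm⟩
  | add A B _ _ hA hB =>
    obtain ⟨f, rfl⟩ := hA
    obtain ⟨g, rfl⟩ := hB
    exact ⟨f + g, by rw [add_mul, op_add]⟩
  | smul b A _ hA =>
    obtain ⟨f, rfl⟩ := hA
    exact ⟨b • f, by rw [smul_mul_assoc, op_smul]⟩

lemma op_mem_Dp_one (k : ℤ) (f : Polynomial ℂ) : op k f ∈ Dp 1 :=
  Submodule.subset_span ⟨k, f, by rw [mul_one]⟩

lemma mul_op_mem_Dp {A : Module.End ℂ LaurentV} (hA : A ∈ Dp 1) (p : Polynomial ℂ) :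
    A * op 0 p ∈ Dp p := by
  induction hA using Submodule.span_induction with
  | mem A h =>
    obtain ⟨k, f, rfl⟩ := h
    exact Submodule.subset_span ⟨k, f, by simp [op_mul_op]⟩
  | zero => simp
  | add A B _ _ hA hB => rw [add_mul]; exact add_mem hA hB
  | smul b A _ hA => rw [smul_mul_assoc]; exact Submodule.smul_mem _ _ hA

lemma mul_mem_Dp_one {A B : Module.End ℂ LaurentV} (hA : A ∈ Dp 1) (hB : B ∈ Dp 1) :
    A * B ∈ Dp 1 := by
  refine (Submodule.span_le (p := (Dp 1).comap (LinearMap.mulRight ℂ B))).2 ?_ hA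
  rintro _ ⟨k, f, rfl⟩
  refine (Submodule.span_le
    (p := (Dp 1).comap (LinearMap.mulLeft ℂ (op k (f * 1))))).2 ?_ hB
  rintro _ ⟨m, g, rfl⟩
  simpa [op_mul_op] using op_mem_Dp_one _ _

/-- Each matrix diagonal of an element of `𝒟ᵃ` is polynomial. -/
lemma exists_diagonal_polynomial {A : Module.End ℂ LaurentV} (hA : A ∈ Dp 1) (k : ℤ) :
    ∃ f : Polynomial ℂ, ∀ j : ℤ, A (Finsupp.single j 1) (j + k) = f.eval (j : ℂ) := by
  induction hA using Submodule.span_induction with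
  | mem A h =>
    obtain ⟨m, f, rfl⟩ := h
    by_cases hm : m = k
    · exact ⟨f, fun j => by simp [op_single, hm]⟩
    · exact ⟨0, fun j => by simp [op_single, hm]⟩
  | zero => exact ⟨0, fun j => by simp⟩
  | add A B _ _ hA hB =>
    obtain ⟨f, hf⟩ := hA
    obtain ⟨g, hg⟩ := hB
    exact ⟨f + g, fun j => by simp [hf, hg]⟩
  | smul b A _ hA =>
    obtain ⟨f, hf⟩ := hA
    exact ⟨b • f, fun j => by simp [hf]⟩

lemma eq_zero_of_eval_intCast_eq_zero {f : Polynomial ℂ}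
    (hf : ∀ j : ℤ, f.eval (j : ℂ) = 0) : f = 0 :=
  Polynomial.eq_zero_of_infinite_isRoot f <|
    (Set.infinite_range_of_injective (Int.cast_injective (α := ℂ))).mono <| by
      rintro _ ⟨j, rfl⟩
      exact hf j

lemma eq_zero_of_mul_op_eq_zero {p : Polynomial ℂ} (hp : p ≠ 0) {A : Module.End ℂ LaurentV}
    (hA : A ∈ Dp 1) (h : A * op 0 p = 0) : A = 0 := by
  refine Finsupp.lhom_ext' fun j => LinearMap.ext_ring (Finsupp.ext fun i => ?_)
  obtain ⟨f, hf⟩ := exists_diagonal_polynomial hA (i - j)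
  have hpf : p * f = 0 := eq_zero_of_eval_intCast_eq_zero fun l => by
    have hl := DFunLike.congr_fun (LinearMap.congr_fun h (Finsupp.single l 1)) (l + (i - j))
    rw [Module.End.mul_apply, op_single, add_zero, ← smul_eq_mul, ← Finsupp.smul_single,
      map_smul] at hl
    simpa [hf] using hl
  have := hf j
  rw [(mul_eq_zero.1 hpf).resolve_left hp] at this
  simpa using this

lemma mul_op_right_cancel {p : Polynomial ℂ} (hp : p ≠ 0) {A B : Module.End ℂ LaurentV}
    (hA : A ∈ Dp 1) (hB : B ∈ Dp 1) (h : A * op 0 p = B * op 0 p) : A = B := by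
  have hAB : A + (-1 : ℂ) • B = 0 :=
    eq_zero_of_mul_op_eq_zero hp (add_mem hA (Submodule.smul_mem _ _ hB)) <| by
      rw [add_mul, smul_mul_assoc, h]
      ext
      simp
  refine LinearMap.ext fun v => ?_
  simpa [add_neg_eq_zero] using LinearMap.congr_fun hAB v

theorem sigma0_properties (p : Polynomial ℂ) (hp : p ≠ 0)
    (σ : ↥(Dp p) →ₗ[ℂ] ↥(Dp p)) (h1 : IsAntiInvolutionOn p σ) (h2 : PreservesGrading p σ)
    (σ₀ : ↥(Dp 1) → ↥(Dp 1))
    (hσ₀ : ∀ (A : ↥(Dp 1)) (Y : ↥(Dp p)),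
      (Y : Module.End ℂ LaurentV) = (A : Module.End ℂ LaurentV) * op 0 p →
      ((σ Y : Module.End ℂ LaurentV)) = (σ₀ A : Module.End ℂ LaurentV) * op 0 p) :
    -- (a) σ₀ is ℂ-linear
    (∀ (b : ℂ) (A B : ↥(Dp 1)), σ₀ (b • A + B) = b • σ₀ A + σ₀ B) ∧
    -- (b) σ₀ ∘ σ₀ = id
    (∀ A : ↥(Dp 1), σ₀ (σ₀ A) = A) ∧
    -- (c) σ₀(t^{k+m} f(D+m) p(D+m) g(D)) = σ₀(t^m g(D))·p(D)·σ₀(t^k f(D))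
    (∀ (k m : ℤ) (f g : Polynomial ℂ) (A B W : ↥(Dp 1)),
      (A : Module.End ℂ LaurentV) = op k f →
      (B : Module.End ℂ LaurentV) = op m g →
      (W : Module.End ℂ LaurentV) =
        op (k + m) (f.comp (Polynomial.X + Polynomial.C (m : ℂ)) *
          p.comp (Polynomial.X + Polynomial.C (m : ℂ)) * g) →
      ((σ₀ W : Module.End ℂ LaurentV)) =
        (σ₀ B : Module.End ℂ LaurentV) * op 0 p * (σ₀ A : Module.End ℂ LaurentV)) ∧
    -- (d) σ₀(f(D)g(D)p(D)) = σ₀(f(D))·σ₀(g(D))·p(D)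
    (∀ (f g : Polynomial ℂ) (A B W : ↥(Dp 1)),
      (A : Module.End ℂ LaurentV) = op 0 f →
      (B : Module.End ℂ LaurentV) = op 0 g →
      (W : Module.End ℂ LaurentV) = op 0 (f * g * p) →
      ((σ₀ W : Module.End ℂ LaurentV)) =
        (σ₀ A : Module.End ℂ LaurentV) * (σ₀ B : Module.End ℂ LaurentV) * op 0 p) := by
  let R (A : ↥(Dp 1)) : ↥(Dp p) := ⟨A * op 0 p, mul_op_mem_Dp A.2 p⟩
  have hR (A : ↥(Dp 1)) : σ (R A) = R (σ₀ A) := Subtype.ext (hσ₀ A (R A) rfl)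
  have cancel : Function.Injective R := fun A B h =>
    Subtype.ext (mul_op_right_cancel hp A.2 B.2 (congrArg Subtype.val h))
  have anti : ∀ (k m : ℤ) (f g : Polynomial ℂ) (A B W : ↥(Dp 1)),
      (A : Module.End ℂ LaurentV) = op k f →
      (B : Module.End ℂ LaurentV) = op m g →
      (W : Module.End ℂ LaurentV) =
        op (k + m) (f.comp (Polynomial.X + Polynomial.C (m : ℂ)) *
          p.comp (Polynomial.X + Polynomial.C (m : ℂ)) * g) →
      ((σ₀ W : Module.End ℂ LaurentV)) =
        (σ₀ B : Module.End ℂ LaurentV) * op 0 p * (σ₀ A : Module.End ℂ LaurentV) := by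
    intro k m f g A B W hA hB hW
    refine mul_op_right_cancel hp (σ₀ W).2
      (mul_mem_Dp_one (mul_mem_Dp_one (σ₀ B).2 (op_mem_Dp_one 0 p)) (σ₀ A).2) ?_
    have h := h1.2 (R A) (R B) (R W) (by
      simp only [R, hA, hB, hW, op_mul_op, Polynomial.mul_comp]
      simp [mul_assoc])
    rw [hR, hR, hR] at h
    simpa only [R, mul_assoc] using h
  have degree_zero (f : Polynomial ℂ) (A : ↥(Dp 1))
      (hA : (A : Module.End ℂ LaurentV) = op 0 f) :
      ∃ h : Polynomial ℂ, (σ₀ A : Module.End ℂ LaurentV) = op 0 h := by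
    have hmem := h2 0 (R A) (Submodule.subset_span
      ⟨f, by simp only [R, hA, op_zero_mul_op_zero]⟩)
    rw [hR] at hmem
    obtain ⟨h, hh⟩ := exists_eq_op_of_mem_Dgrade hmem
    exact ⟨h, mul_op_right_cancel hp (σ₀ A).2 (op_mem_Dp_one 0 h)
      (by rw [op_zero_mul_op_zero]; exact hh)⟩
  refine ⟨fun b A B => cancel ?_, fun A => cancel ?_, anti, ?_⟩
  · have hlin (A B : ↥(Dp 1)) : R (b • A + B) = b • R A + R B :=
      Subtype.ext (by simp [R, add_mul])
    rw [← hR, hlin, map_add, map_smul, hR, hR, hlin]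
  · rw [← hR, ← hR, h1.1]
  · intro f g A B W hA hB hW
    rw [anti 0 0 f g A B W hA hB (by simp [hW, mul_right_comm])]
    obtain ⟨u, hu⟩ := degree_zero f A hA
    obtain ⟨v, hv⟩ := degree_zero g B hB
    simp only [hu, hv, op_zero_mul_op_zero]
    congr 1
    ring

end
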